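/- Let 0 < β < 1, δ > 0, r > 0, k₀ > 0 and set σ = (r + δ)/(βδ). Define k(t) = [ β/(r+δ) + (k₀^{1−β} − β/(r+δ)) e^{−(1−β)δ t} ]^{1/(1−β)} and c(t) = (1 − βδ/(r+δ)) k(t)^{β} for t ≥ 0. Then k(t) > 0 and c(t) > 0, and the pair (k, c) solves the Ramsey system k̇ = k^β − δk − c and ċ/c = (β/σ) k^{β−1} − (δ + r)/σ, with k(0) = k₀. -/

import Mathlib

/-- With `σ = (r+δ)/(βδ)`, the explicit pair
`k(t) = [β/(r+δ) + (k₀^{1−β} − β/(r+δ)) e^{−(1−β)δt}]^{1/(1−β)}`,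
`c(t) = (1 − βδ/(r+δ)) k(t)^β` is positive on `t ≥ 0`, satisfies `k(0) = k₀`,
and solves the Ramsey system `k̇ = k^β − δk − c`,
`ċ/c = (β/σ) k^{β−1} − (δ+r)/σ` for `t ≥ 0`. -/
theorem ramsey_explicit_solution
    (β δ r k₀ σ : ℝ) (hβ0 : 0 < β) (hβ1 : β < 1) (hδ : 0 < δ) (hr : 0 < r)
    (hk₀ : 0 < k₀) (hσ : σ = (r + δ) / (β * δ)) :
    let k : ℝ → ℝ := fun t =>
      (β / (r + δ) + (k₀ ^ (1 - β) - β / (r + δ)) * Real.exp (-((1 - β) * δ * t)))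
        ^ (1 / (1 - β))
    let c : ℝ → ℝ := fun t => (1 - β * δ / (r + δ)) * k t ^ β
    (∀ t : ℝ, 0 ≤ t → 0 < k t) ∧ (∀ t : ℝ, 0 ≤ t → 0 < c t) ∧ k 0 = k₀ ∧
      (∀ t : ℝ, 0 ≤ t → deriv k t = k t ^ β - δ * k t - c t) ∧
      (∀ t : ℝ, 0 ≤ t →
        deriv c t / c t = (β / σ) * k t ^ (β - 1) - (δ + r) / σ) := by
  intro k c
  have hb : 0 < 1 - β := by linarith
  have hrd : 0 < r + δ := by linarith
  have hB : 0 < β / (r + δ) := div_pos hβ0 hrd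
  have hA : 0 < 1 - β * δ / (r + δ) := by
    rw [sub_pos, div_lt_one hrd]
    nlinarith
  have hz0 : 0 < k₀ ^ (1 - β) := Real.rpow_pos_of_pos hk₀ _
  have hz : ∀ t : ℝ, 0 ≤ t →
      0 < β / (r + δ) + (k₀ ^ (1 - β) - β / (r + δ)) * Real.exp (-((1 - β) * δ * t)) := by
    intro t ht
    have h1 : Real.exp (-((1 - β) * δ * t)) ≤ 1 := by
      apply Real.exp_le_one_iff.mpr
      have : 0 ≤ (1 - β) * δ * t := by positivity
      linarith
    have h2 := mul_pos hz0 (Real.exp_pos (-((1 - β) * δ * t)))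
    have h3 := mul_nonneg hB.le (sub_nonneg.mpr h1)
    nlinarith
  have hk : ∀ t : ℝ, 0 ≤ t → 0 < k t := fun t ht => Real.rpow_pos_of_pos (hz t ht) _
  have hc : ∀ t : ℝ, 0 ≤ t → 0 < c t :=
    fun t ht => mul_pos hA (Real.rpow_pos_of_pos (hk t ht) _)
  have hdk : ∀ t : ℝ, 0 ≤ t → HasDerivAt k (k t ^ β - δ * k t - c t) t := by
    intro t ht
    have he : HasDerivAt (fun t : ℝ => -((1 - β) * δ * t)) (-((1 - β) * δ * 1)) t :=
      ((hasDerivAt_id t).const_mul ((1 - β) * δ)).neg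
    have hd := ((he.exp.const_mul (k₀ ^ (1 - β) - β / (r + δ))).const_add
      (β / (r + δ))).rpow_const (p := 1 / (1 - β)) (Or.inl (hz t ht).ne')
    refine hd.congr_deriv ?_
    have hzt := hz t ht
    simp only [c, k]
    generalize hE : Real.exp (-((1 - β) * δ * t)) = E at hzt ⊢
    generalize hZ : β / (r + δ) + (k₀ ^ (1 - β) - β / (r + δ)) * E = Z at hzt ⊢
    have e1 : (Z ^ (1 / (1 - β))) ^ β = Z ^ (1 / (1 - β) - 1) := by
      rw [← Real.rpow_mul hzt.le]
      congr 1
      field_simp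
      ring
    have e2 : Z ^ (1 / (1 - β)) = Z ^ (1 / (1 - β) - 1) * Z := by
      rw [← Real.rpow_add_one hzt.ne']
      congr 1
      ring
    rw [e1, e2]
    generalize Z ^ (1 / (1 - β) - 1) = P
    have e3 : (k₀ ^ (1 - β) - β / (r + δ)) * E = Z - β / (r + δ) := by rw [← hZ]; ring
    have e4 : (k₀ ^ (1 - β) - β / (r + δ)) * (E * -((1 - β) * δ * 1))
        = (Z - β / (r + δ)) * -((1 - β) * δ) := by rw [← e3]; ring
    rw [e4]
    field_simp
    ring
  refine ⟨hk, hc, ?_, fun t ht => (hdk t ht).deriv, ?_⟩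
  · simp only [k, mul_zero, neg_zero, Real.exp_zero, mul_one, add_sub_cancel]
    rw [← Real.rpow_mul hk₀.le, mul_one_div_cancel hb.ne', Real.rpow_one]
  · intro t ht
    have hkt := hk t ht
    have hd : HasDerivAt c _ t :=
      ((hdk t ht).rpow_const (p := β) (Or.inl hkt.ne')).const_mul (1 - β * δ / (r + δ))
    rw [hd.deriv]
    have hct : c t = (1 - β * δ / (r + δ)) * k t ^ β := rfl
    rw [hct, hσ]
    have e1 : k t ^ β = k t ^ (β - 1) * k t := by
      rw [← Real.rpow_add_one hkt.ne']
      congr 1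
      ring
    rw [e1]
    have hP : 0 < k t ^ (β - 1) := Real.rpow_pos_of_pos hkt _
    generalize k t ^ (β - 1) = P at hP ⊢
    generalize k t = K at hkt ⊢
    rw [mul_div_mul_left _ _ hA.ne']
    field_simp
    ring
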